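/- Let γ_d be the standard Gaussian measure on ℝ^d and let b : ℝ^d → ℝ^d be continuously differentiable with div b(x) = 0 and ⟨x, b(x)⟩ = 0 for all x ∈ ℝ^d. Suppose φ : ℝ × ℝ^d → ℝ^d is a global flow for b, i.e. φ(0,x) = x and ∂_t φ(t,x) = b(φ(t,x)) for all t ∈ ℝ, x ∈ ℝ^d. Then for every t ∈ ℝ the map x ↦ φ(t,x) is measure preserving for γ_d, i.e. the pushforward of γ_d under φ(t,·) equals γ_d. -/

import Mathlib

open MeasureTheory ProbabilityTheory

/-- The standard Gaussian measure on `ℝ^d`: the `d`-fold product of the centered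
Gaussian measure with variance `1` on `ℝ`. -/
noncomputable def stdGaussian (d : ℕ) : Measure (Fin d → ℝ) :=
  Measure.pi fun _ => gaussianReal 0 1

namespace GFlow
open Set Filter Topology Metric
open scoped NNReal ENNReal

lemma ext_lip {d : ℕ} (μ ν : Measure (Fin d → ℝ)) [IsProbabilityMeasure μ] [IsProbabilityMeasure ν]
    (h : ∀ (f : (Fin d → ℝ) → ℝ) (L : ℝ≥0), LipschitzWith L f → (∀ x, |f x| ≤ 1) →
      ∫ x, f x ∂μ = ∫ x, f x ∂ν) : μ = ν := by
  refine ext_of_generate_finite _ (BorelSpace.measurable_eq.trans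
    borel_eq_generateFrom_isClosed) isPiSystem_isClosed ?_ (by simp)
  intro s hs
  have k1 := tendsto_integral_thickenedIndicator_of_isClosed μ hs (δs := fun n : ℕ ↦ (1 : ℝ) / (n + 1))
      (fun _ ↦ by positivity) tendsto_one_div_add_atTop_nhds_zero_nat
  have k2 := tendsto_integral_thickenedIndicator_of_isClosed ν hs (δs := fun n : ℕ ↦ (1 : ℝ) / (n + 1))
      (fun _ ↦ by positivity) tendsto_one_div_add_atTop_nhds_zero_nat
  have e : μ.real s = ν.real s := by
    refine tendsto_nhds_unique k1 (k2.congr fun n => (h _ _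
      (lipschitzWith_thickenedIndicator (δ := (1 : ℝ) / (n + 1)) (by positivity) s) ?_).symm)
    intro x
    have := thickenedIndicator_le_one (δ := (1 : ℝ) / (n + 1)) (by positivity) s x
    have h0 : (0 : ℝ) ≤ ((thickenedIndicator (δ := (1 : ℝ) / (n + 1)) (by positivity) s x : ℝ≥0) : ℝ) :=
      NNReal.coe_nonneg _
    have h1 : ((thickenedIndicator (δ := (1 : ℝ) / (n + 1)) (by positivity) s x : ℝ≥0) : ℝ) ≤ 1 := by
      exact_mod_cast this
    exact abs_le.2 ⟨le_trans (by norm_num) h0, h1⟩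
  simpa [measureReal_eq_measureReal_iff] using e

lemma density (d : ℕ) : stdGaussian d =
    (volume : Measure (Fin d → ℝ)).withDensity
      (fun x => ENNReal.ofReal (∏ i, gaussianPDFReal 0 1 (x i))) := by
  refine Measure.pi_eq fun s hs => ?_
  rw [withDensity_apply _ (MeasurableSet.univ_pi hs)]
  have hint : ∀ i, Integrable (fun y => (s i).indicator (gaussianPDFReal 0 1) y) volume :=
    fun i => (integrable_gaussianPDFReal 0 1).indicator (hs i)
  rw [← lintegral_indicator (MeasurableSet.univ_pi hs)]
  have e : ∀ x : Fin d → ℝ, (univ.pi s).indicator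
      (fun x => ENNReal.ofReal (∏ i, gaussianPDFReal 0 1 (x i))) x =
      ENNReal.ofReal (∏ i, (s i).indicator (gaussianPDFReal 0 1) (x i)) := by
    intro x
    by_cases hx : x ∈ univ.pi s
    · rw [indicator_of_mem hx]
      congr 1
      refine Finset.prod_congr rfl fun i _ => ?_
      rw [indicator_of_mem (hx i (mem_univ i))]
    · rw [indicator_of_notMem hx]
      simp only [Set.mem_pi, mem_univ, true_imp_iff, not_forall] at hx
      obtain ⟨i, hi⟩ := hx
      rw [Finset.prod_eq_zero (Finset.mem_univ i) (indicator_of_notMem hi _)]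
      simp
  have nn : ∀ i y, 0 ≤ (s i).indicator (gaussianPDFReal 0 1) y := fun i y =>
    indicator_nonneg (fun y _ => gaussianPDFReal_nonneg 0 1 y) y
  simp_rw [e]
  have hI : Integrable (fun x : Fin d → ℝ => ∏ i, (s i).indicator (gaussianPDFReal 0 1) (x i))
      volume := Integrable.fintype_prod hint
  rw [← ofReal_integral_eq_lintegral_ofReal hI
    (ae_of_all _ fun x => Finset.prod_nonneg fun i _ => nn i _),
    integral_fintype_prod_volume_eq_prod (f := fun i y => (s i).indicator (gaussianPDFReal 0 1) y),
    ENNReal.ofReal_prod_of_nonneg (fun i _ => integral_nonneg (nn i))]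
  refine Finset.prod_congr rfl fun i _ => ?_
  rw [gaussianReal_apply_eq_integral 0 one_ne_zero, integral_indicator (hs i)]

lemma integral_gauss (d : ℕ) (F : (Fin d → ℝ) → ℝ) :
    ∫ x, F x ∂(stdGaussian d) =
      ∫ x : Fin d → ℝ, F x * ((√(2 * Real.pi))⁻¹ ^ d * Real.exp (-(∑ i, x i ^ 2) / 2)) := by
  rw [density, integral_withDensity_eq_integral_toReal_smul]
  · congr 1; ext x
    rw [ENNReal.toReal_ofReal (Finset.prod_nonneg fun i _ => gaussianPDFReal_nonneg _ _ _)]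
    simp only [gaussianPDFReal, Finset.prod_mul_distrib, ← Real.exp_sum, smul_eq_mul]
    simp [mul_comm, ← Finset.sum_div, neg_div, Finset.sum_neg_distrib]
  · refine Measurable.ennreal_ofReal (Finset.measurable_prod _ fun i _ =>
      (measurable_gaussianPDFReal 0 1).comp (measurable_pi_apply i))
  · simp

variable {d : ℕ} {b : (Fin d → ℝ) → Fin d → ℝ} {φ : ℝ → (Fin d → ℝ) → Fin d → ℝ}

lemma norm_sq_const (horth : ∀ x, (∑ i, x i * b x i) = 0) (hφ0 : ∀ x, φ 0 x = x)
    (hφ' : ∀ t x, HasDerivAt (fun s => φ s x) (b (φ t x)) t) (t : ℝ) (x : Fin d → ℝ) :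
    ∑ i, φ t x i ^ 2 = ∑ i, x i ^ 2 := by
  have hd : ∀ s, HasDerivAt (fun s => ∑ i, φ s x i ^ 2) 0 s := by
    intro s
    have := HasDerivAt.fun_sum (u := Finset.univ) fun i _ => ((hasDerivAt_pi.1 (hφ' s x)) i).pow 2
    convert! this using 1
    have h := horth (φ s x)
    rw [← mul_zero (2:ℝ), ← h, Finset.mul_sum]
    refine Finset.sum_congr rfl fun i _ => by simp; ring
  have := is_const_of_deriv_eq_zero (fun s => (hd s).differentiableAt) (fun s => (hd s).deriv) t 0
  simpa [hφ0] using this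

/-- points with norm squared at most `R^2` lie in the sup ball -/
lemma mem_ball_of {R : ℝ} (hR : 0 ≤ R) {x : Fin d → ℝ} (hx : ∑ i, x i ^ 2 ≤ R ^ 2) :
    x ∈ closedBall (0 : Fin d → ℝ) R := by
  rw [mem_closedBall_zero_iff, pi_norm_le_iff_of_nonneg hR]
  intro i
  rw [Real.norm_eq_abs]
  refine abs_le_of_sq_le_sq (le_trans ?_ hx) hR
  exact Finset.single_le_sum (f := fun i => x i ^ 2) (fun i _ => sq_nonneg _) (Finset.mem_univ i)

lemma lip_b (hb : ContDiff ℝ 1 b) (R : ℝ) :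
    ∃ K, LipschitzOnWith K b (closedBall (0 : Fin d → ℝ) R) :=
  hb.contDiffOn.exists_lipschitzOnWith one_ne_zero (convex_closedBall _ _) (isCompact_closedBall _ _)

lemma flow_add (hb : ContDiff ℝ 1 b) (horth : ∀ x, (∑ i, x i * b x i) = 0) (hφ0 : ∀ x, φ 0 x = x)
    (hφ' : ∀ t x, HasDerivAt (fun s => φ s x) (b (φ t x)) t) (t h : ℝ) (x : Fin d → ℝ) :
    φ (t + h) x = φ t (φ h x) := by
  set R := √(∑ i, x i ^ 2)
  have hR : 0 ≤ R := Real.sqrt_nonneg _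
  have hR2 : R ^ 2 = ∑ i, x i ^ 2 := Real.sq_sqrt (Finset.sum_nonneg fun i _ => sq_nonneg _)
  obtain ⟨K, hK⟩ := lip_b hb R
  have hN := norm_sq_const horth hφ0 hφ'
  have := ODE_solution_unique_univ (v := fun _ => b) (s := fun _ => closedBall (0 : Fin d → ℝ) R)
    (f := fun s => φ (s + h) x) (g := fun s => φ s (φ h x)) (t₀ := 0) (K := K) (fun _ => hK)
    (fun s => ⟨(hφ' (s + h) x).comp_add_const s h, mem_ball_of hR (by rw [hN, hR2])⟩)
    (fun s => ⟨hφ' s _, mem_ball_of hR (by rw [hN, hN, hR2])⟩) (by simp [hφ0])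
  exact congrFun this t

lemma lip_flow_pos (hb : ContDiff ℝ 1 b) (horth : ∀ x, (∑ i, x i * b x i) = 0)
    (hφ0 : ∀ x, φ 0 x = x)
    (hφ' : ∀ t x, HasDerivAt (fun s => φ s x) (b (φ t x)) t) (t : ℝ) (ht : 0 ≤ t)
    {R : ℝ} (hR : 0 ≤ R) :
    ∃ L, LipschitzOnWith L (φ t) {x | ∑ i, x i ^ 2 ≤ R ^ 2} := by
  obtain ⟨K, hK⟩ := lip_b hb R
  have hN := norm_sq_const horth hφ0 hφ'
  refine ⟨⟨Real.exp (K * t), (Real.exp_pos _).le⟩, LipschitzOnWith.of_dist_le_mul fun x hx y hy => ?_⟩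
  have := dist_le_of_trajectories_ODE_of_mem (v := fun _ => b)
    (s := fun _ => closedBall (0 : Fin d → ℝ) R) (a := 0) (b := t)
    (f := fun s => φ s x) (g := fun s => φ s y) (K := K) (δ := dist x y) (fun _ _ => hK)
    (fun s _ => (hφ' s x).continuousAt.continuousWithinAt) (fun s _ => (hφ' s x).hasDerivWithinAt)
    (fun s _ => mem_ball_of hR (by rw [hN]; exact hx))
    (fun s _ => (hφ' s y).continuousAt.continuousWithinAt) (fun s _ => (hφ' s y).hasDerivWithinAt)
    (fun s _ => mem_ball_of hR (by rw [hN]; exact hy)) (by simp [hφ0]) t ⟨ht, le_rfl⟩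
  simp only [sub_zero] at this
  rw [mul_comm] at this
  exact this

lemma lip_flow (hb : ContDiff ℝ 1 b) (horth : ∀ x, (∑ i, x i * b x i) = 0)
    (hφ0 : ∀ x, φ 0 x = x)
    (hφ' : ∀ t x, HasDerivAt (fun s => φ s x) (b (φ t x)) t) (t : ℝ)
    {R : ℝ} (hR : 0 ≤ R) :
    ∃ L, LipschitzOnWith L (φ t) {x | ∑ i, x i ^ 2 ≤ R ^ 2} := by
  rcases le_total 0 t with ht | ht
  · exact lip_flow_pos hb horth hφ0 hφ' t ht hR
  · have := lip_flow_pos (b := fun x => - b x) (φ := fun s => φ (-s)) hb.neg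
      (fun x => by simp [horth]) (by simpa using hφ0)
      (fun s x => by
        have := (hφ' (-s) x).scomp s (hasDerivAt_neg s)
        simpa [Function.comp_def] using this) (-t) (by linarith) hR
    simpa using this

lemma cont_flow (hb : ContDiff ℝ 1 b) (horth : ∀ x, (∑ i, x i * b x i) = 0)
    (hφ0 : ∀ x, φ 0 x = x)
    (hφ' : ∀ t x, HasDerivAt (fun s => φ s x) (b (φ t x)) t) (t : ℝ) : Continuous (φ t) := by
  rw [continuous_iff_continuousAt]
  intro x
  obtain ⟨L, hL⟩ := lip_flow hb horth hφ0 hφ' t (R := √(∑ i, x i ^ 2) + 1) (by positivity)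
  refine hL.continuousOn.continuousAt ?_
  have hc : Continuous fun y : Fin d → ℝ => ∑ i, y i ^ 2 := by fun_prop
  refine (hc.tendsto x).eventually (p := fun z => z ≤ (√(∑ i, x i ^ 2) + 1) ^ 2) ?_
  refine eventually_le_nhds ?_
  have := Real.sq_sqrt (Finset.sum_nonneg fun i (_ : i ∈ Finset.univ) => sq_nonneg (x i))
  have := Real.sqrt_nonneg (∑ i, x i ^ 2)
  nlinarith

lemma ibp (hb : ContDiff ℝ 1 b) (hdiv : ∀ x, (∑ i, fderiv ℝ b x (Pi.single i 1) i) = 0)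
    (horth : ∀ x, (∑ i, x i * b x i) = 0) {h : ℝ → ℝ} (hh : ContDiff ℝ 1 h)
    (hw : HasCompactSupport (fun x : Fin d → ℝ => h (∑ i, x i ^ 2)))
    {g : (Fin d → ℝ) → ℝ} {C : ℝ≥0} (hg : LipschitzWith C g) :
    ∫ x, fderiv ℝ g x (b x) * h (∑ i, x i ^ 2) = 0 := by
  set w : (Fin d → ℝ) → ℝ := fun x => h (∑ i, x i ^ 2) with hwdef
  have hwc : ContDiff ℝ 1 w := hh.comp (by fun_prop)
  have hbi : ∀ i, ContDiff ℝ 1 (fun x => b x i) := fun i => contDiff_pi.1 hb i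
  have hu : ∀ i, ContDiff ℝ 1 (fun x => b x i * w x) := fun i => (hbi i).mul hwc
  have huc : ∀ i, HasCompactSupport (fun x => b x i * w x) := fun i => hw.mul_left
  choose D hD using fun i => (hu i).lipschitzWith_of_hasCompactSupport (huc i) one_ne_zero
  have I1 : ∀ i, Integrable (fun x => lineDeriv ℝ g x (Pi.single i 1) * (b x i * w x)) := by
    intro i
    have := ((hu i).continuous.integrable_of_hasCompactSupport (huc i) (μ := volume))
    exact this.bdd_mul (c := C * ‖(Pi.single i 1 : Fin d → ℝ)‖)
      (aestronglyMeasurable_lineDeriv hg.continuous _)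
      (ae_of_all _ fun x => norm_lineDeriv_le_of_lipschitz ℝ hg)
  have I2 : ∀ i, Integrable
      (fun x => lineDeriv ℝ (fun x => b x i * w x) x (-Pi.single i 1) * g x) := by
    intro i
    have e : ∀ x, lineDeriv ℝ (fun x => b x i * w x) x (-Pi.single i 1)
      = fderiv ℝ (fun x => b x i * w x) x (-Pi.single i 1) := fun x =>
      ((hu i).differentiable one_ne_zero x).lineDeriv_eq_fderiv
    simp_rw [e]
    have hc := (hu i).continuous_fderiv one_ne_zero
    refine Continuous.integrable_of_hasCompactSupport
      ((hc.clm_apply continuous_const).mul hg.continuous) ?_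
    exact (((huc i).fderiv ℝ).comp_left (g := fun L : (Fin d → ℝ) →L[ℝ] ℝ => L (-Pi.single i 1))
      (by simp)).mul_right
  calc ∫ x, fderiv ℝ g x (b x) * w x
      = ∫ x, ∑ i, lineDeriv ℝ g x (Pi.single i 1) * (b x i * w x) := by
        refine integral_congr_ae ?_
        filter_upwards [hg.ae_differentiableAt] with x hx
        have : b x = ∑ i, b x i • (Pi.single i 1 : Fin d → ℝ) := by
          ext j; simp [Finset.sum_apply, Pi.single_apply]
        conv_lhs => rw [this]
        rw [map_sum, Finset.sum_mul]
        refine Finset.sum_congr rfl fun i _ => ?_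
        rw [hx.lineDeriv_eq_fderiv, map_smul, smul_eq_mul]; ring
    _ = ∑ i, ∫ x, lineDeriv ℝ g x (Pi.single i 1) * (b x i * w x) :=
        integral_finsetSum _ fun i _ => I1 i
    _ = ∑ i, ∫ x, lineDeriv ℝ (fun x => b x i * w x) x (-Pi.single i 1) * g x :=
        Finset.sum_congr rfl fun i _ => hg.integral_lineDeriv_mul_eq (hD i) (huc i) _
    _ = ∫ x, ∑ i, lineDeriv ℝ (fun x => b x i * w x) x (-Pi.single i 1) * g x :=
        (integral_finsetSum _ fun i _ => I2 i).symm
    _ = 0 := by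
        refine integral_eq_zero_of_ae (ae_of_all _ fun x => ?_)
        simp only [Pi.zero_apply]
        rw [← Finset.sum_mul]
        convert zero_mul _
        have hwd : HasFDerivAt w (deriv h (∑ i, x i ^ 2) •
            ∑ i, (2 * x i) • (ContinuousLinearMap.proj i : (Fin d → ℝ) →L[ℝ] ℝ)) x := by
          have h1 : HasDerivAt h (deriv h (∑ i, x i ^ 2)) (∑ i, x i ^ 2) :=
            (hh.differentiable one_ne_zero _).hasDerivAt
          refine h1.comp_hasFDerivAt x ?_
          refine HasFDerivAt.fun_sum fun i _ => ?_
          have := (ContinuousLinearMap.proj (R := ℝ) (φ := fun _ : Fin d => ℝ) i).hasFDerivAt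
            (x := x) |>.pow 2
          simpa using this
        have hbd : ∀ i, HasFDerivAt (fun x => b x i)
            ((ContinuousLinearMap.proj i).comp (fderiv ℝ b x)) x := fun i =>
          (hasFDerivAt_pi'.1 (hb.differentiable one_ne_zero x).hasFDerivAt) i
        have e : ∀ i, lineDeriv ℝ (fun x => b x i * w x) x (-Pi.single i 1)
            = - (fderiv ℝ b x (Pi.single i 1) i * w x
              + 2 * deriv h (∑ i, x i ^ 2) * (x i * b x i)) := by
          intro i
          have : HasFDerivAt (fun x => b x i * w x) _ x := (hbd i).mul hwd
          rw [this.hasLineDerivAt _ |>.lineDeriv]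
          simp [Pi.single_apply]
          ring
        simp_rw [e]
        rw [Finset.sum_neg_distrib, Finset.sum_add_distrib, ← Finset.sum_mul, hdiv,
          ← Finset.mul_sum, horth]
        simp

lemma key (hb : ContDiff ℝ 1 b) (hdiv : ∀ x, (∑ i, fderiv ℝ b x (Pi.single i 1) i) = 0)
    (horth : ∀ x, (∑ i, x i * b x i) = 0) (hφ0 : ∀ x, φ 0 x = x)
    (hφ' : ∀ t x, HasDerivAt (fun s => φ s x) (b (φ t x)) t)
    {h : ℝ → ℝ} (hh : ContDiff ℝ 1 h) {R : ℝ} (hR : 0 ≤ R) (hhR : ∀ s, R ^ 2 ≤ s → h s = 0)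
    {f : (Fin d → ℝ) → ℝ} {C : ℝ≥0} (hf : LipschitzWith C f) (t : ℝ) :
    HasDerivAt (fun t => ∫ x, f (φ t x) * h (∑ i, x i ^ 2)) 0 t := by
  have hN := norm_sq_const horth hφ0 hφ'
  have hmem : ∀ x : Fin d → ℝ, h (∑ i, x i ^ 2) ≠ 0 → ∑ i, x i ^ 2 ≤ R ^ 2 := fun x hx =>
    (not_le.1 fun h' => hx (hhR _ h')).le
  have hwcont : Continuous (fun x : Fin d → ℝ => h (∑ i, x i ^ 2)) :=
    hh.continuous.comp (by fun_prop)
  have hw : HasCompactSupport (fun x : Fin d → ℝ => h (∑ i, x i ^ 2)) :=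
    HasCompactSupport.of_support_subset_isCompact (isCompact_closedBall 0 R)
      fun x hx => mem_ball_of hR (hmem x hx)
  obtain ⟨L, hL⟩ := lip_flow hb horth hφ0 hφ' t hR
  obtain ⟨g, hg, hgf⟩ := (hf.comp_lipschitzOnWith hL).extend_real
  -- bound on `b`
  obtain ⟨M, hM⟩ := (isCompact_closedBall (0 : Fin d → ℝ) R).exists_bound_of_continuousOn
    hb.continuous.continuousOn
  have hM' : ∀ x : Fin d → ℝ, ∑ i, x i ^ 2 ≤ R ^ 2 →
      LipschitzWith M.toNNReal (fun s => φ s x) := by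
    intro x hx
    refine lipschitzWith_of_nnnorm_deriv_le (fun s => (hφ' s x).differentiableAt) fun s => ?_
    rw [(hφ' s x).deriv]
    have := hM (φ s x) (mem_ball_of hR (by rw [hN]; exact hx))
    rw [← norm_toNNReal]
    exact Real.toNNReal_le_toNNReal this
  have main := hasDerivAt_integral_of_dominated_loc_of_lip (μ := (volume : Measure (Fin d → ℝ)))
    (F := fun s x => g (φ s x) * h (∑ i, x i ^ 2))
    (F' := fun x => fderiv ℝ g x (b x) * h (∑ i, x i ^ 2)) (x₀ := 0) (s := univ)
    (bound := fun x => (C * L * M.toNNReal : ℝ≥0) * |h (∑ i, x i ^ 2)|)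
    univ_mem
    (Eventually.of_forall fun s => ((hg.continuous.comp (cont_flow hb horth hφ0 hφ' s)).mul
      hwcont).aestronglyMeasurable)
    (((hg.continuous.comp (cont_flow hb horth hφ0 hφ' 0)).mul
      hwcont).integrable_of_hasCompactSupport hw.mul_left)
    ?_ ?_ ?_ ?_
  · have h2 := main.2
    rw [ibp hb hdiv horth hh hw hg] at h2
    have h3 : HasDerivAt (fun s => ∫ x, g (φ (s - t) x) * h (∑ i, x i ^ 2)) 0 t := by
      have := HasDerivAt.comp_sub_const (x := t) (a := t)
        (f := fun s => ∫ x, g (φ s x) * h (∑ i, x i ^ 2)) (f' := 0) (by simpa using h2)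
      exact this
    convert! h3 using 1
    ext s
    congr 1
    ext x
    by_cases hx : h (∑ i, x i ^ 2) = 0
    · simp [hx]
    · have : ∑ i, φ (s - t) x i ^ 2 ≤ R ^ 2 := by rw [hN]; exact hmem x hx
      rw [← hgf this, Function.comp_apply, ← flow_add hb horth hφ0 hφ']
      simp
  · exact ((isBoundedBilinearMap_apply.continuous.measurable.comp
      ((measurable_fderiv ℝ g).prodMk hb.continuous.measurable)).mul hwcont.measurable).aestronglyMeasurable
  · refine ae_of_all _ fun x => ?_
    by_cases hx : h (∑ i, x i ^ 2) = 0
    · simp only [hx, mul_zero]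
      exact (LipschitzWith.const 0).lipschitzOnWith.weaken zero_le
    · have h1 := hg.comp (hM' x (hmem x hx))
      refine LipschitzOnWith.of_dist_le_mul fun s _ s' _ => ?_
      have h2 := h1.dist_le_mul s s'
      simp only [Function.comp_apply, Real.dist_eq] at h2 ⊢
      rw [← sub_mul, abs_mul, Real.coe_nnabs, abs_mul, abs_abs, abs_of_nonneg (NNReal.coe_nonneg _)]
      calc _ ≤ _ := mul_le_mul_of_nonneg_right h2 (abs_nonneg _)
        _ = _ := by ring
  · exact (hwcont.abs.integrable_of_hasCompactSupport hw.abs).const_mul _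
  · filter_upwards [hg.ae_differentiableAt] with x hx
    refine HasDerivAt.mul_const ?_ _
    have h1 := hφ' 0 x
    rw [hφ0] at h1
    exact HasFDerivAt.comp_hasDerivAt_of_eq 0 hx.hasFDerivAt h1 (hφ0 x).symm

lemma integrable_exp (d : ℕ) :
    Integrable (fun x : Fin d → ℝ => Real.exp (-(∑ i, x i ^ 2) / 2)) := by
  have h := integrable_exp_neg_mul_sq (b := 1 / 2) (by norm_num)
  have : Integrable (fun x : Fin d → ℝ => ∏ i, Real.exp (-(1 / 2) * x i ^ 2)) volume :=
    Integrable.fintype_prod fun _ => h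
  convert this using 2 with x
  rw [← Real.exp_sum, ← Finset.mul_sum]
  congr 1; ring

lemma gauss_inv (hb : ContDiff ℝ 1 b) (hdiv : ∀ x, (∑ i, fderiv ℝ b x (Pi.single i 1) i) = 0)
    (horth : ∀ x, (∑ i, x i * b x i) = 0) (hφ0 : ∀ x, φ 0 x = x)
    (hφ' : ∀ t x, HasDerivAt (fun s => φ s x) (b (φ t x)) t)
    {f : (Fin d → ℝ) → ℝ} {C : ℝ≥0} (hf : LipschitzWith C f) (hf1 : ∀ x, |f x| ≤ 1) (t : ℝ) :
    ∫ x, f (φ t x) * Real.exp (-(∑ i, x i ^ 2) / 2) = ∫ x, f x * Real.exp (-(∑ i, x i ^ 2) / 2) := by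
  let χ : ℕ → ℝ → ℝ := fun n s => Real.exp (-s / 2) * Real.smoothTransition (((n : ℝ) + 1) ^ 2 - s)
  have hχ : ∀ n, ContDiff ℝ 1 (χ n) := fun n =>
    ContDiff.mul (by fun_prop) (Real.smoothTransition.contDiff.comp (by fun_prop))
  have hχ0 : ∀ (n : ℕ) (s : ℝ), ((n : ℝ) + 1) ^ 2 ≤ s → χ n s = 0 := fun n s hs => by
    simp only [χ]
    rw [Real.smoothTransition.zero_of_nonpos (by linarith), mul_zero]
  have hχb : ∀ n s, |χ n s| ≤ Real.exp (-s / 2) := fun n s => by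
    simp only [χ]
    rw [abs_mul, abs_of_pos (Real.exp_pos _), abs_of_nonneg (Real.smoothTransition.nonneg _)]
    exact mul_le_of_le_one_right (Real.exp_pos _).le (Real.smoothTransition.le_one _)
  have hχl : ∀ s, Tendsto (fun n => χ n s) atTop (𝓝 (Real.exp (-s / 2))) := fun s => by
    refine tendsto_const_nhds.congr' ?_
    filter_upwards [eventually_ge_atTop ⌈s⌉₊] with n hn
    have h1 : s ≤ n := (Nat.le_ceil s).trans (by exact_mod_cast hn)
    simp only [χ]
    rw [Real.smoothTransition.one_of_one_le, mul_one]
    have : (0 : ℝ) ≤ n := n.cast_nonneg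
    nlinarith
  have lim : ∀ u, Tendsto (fun n => ∫ x, f (φ u x) * χ n (∑ i, x i ^ 2)) atTop
      (𝓝 (∫ x, f (φ u x) * Real.exp (-(∑ i, x i ^ 2) / 2))) := by
    intro u
    refine tendsto_integral_of_dominated_convergence _ (fun n => ?_) (integrable_exp d)
      (fun n => ae_of_all _ fun x => ?_) (ae_of_all _ fun x => (hχl _).const_mul _)
    · exact ((hf.continuous.comp (cont_flow hb horth hφ0 hφ' u)).mul
        ((hχ n).continuous.comp (by fun_prop))).aestronglyMeasurable
    · rw [norm_mul, Real.norm_eq_abs, Real.norm_eq_abs]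
      calc _ ≤ 1 * |χ n (∑ i, x i ^ 2)| := mul_le_mul_of_nonneg_right (hf1 _) (abs_nonneg _)
        _ ≤ _ := by rw [one_mul]; exact hχb _ _
  have e : ∀ n, ∫ x, f (φ t x) * χ n (∑ i, x i ^ 2) = ∫ x, f (φ 0 x) * χ n (∑ i, x i ^ 2) := by
    intro n
    have hd := key hb hdiv horth hφ0 hφ' (hχ n) (R := (n : ℝ) + 1) (by positivity) (hχ0 n) hf
    exact is_const_of_deriv_eq_zero (fun s => (hd s).differentiableAt) (fun s => (hd s).deriv) t 0
  have l0 := lim 0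
  simp only [← e] at l0
  have := tendsto_nhds_unique (lim t) l0
  simpa only [hφ0] using this
end GFlow

/-- If `b : ℝ^d → ℝ^d` is `C¹` with `div b = 0` and `⟨x, b(x)⟩ = 0` for all `x`, and
`φ` is a global flow for `b` (`φ(0,x) = x`, `∂_t φ(t,x) = b(φ(t,x))`), then for every
`t` the map `x ↦ φ(t,x)` pushes the standard Gaussian measure forward to itself. -/
theorem stmt_15 (d : ℕ) (b : (Fin d → ℝ) → Fin d → ℝ) (hb : ContDiff ℝ 1 b)
    (hdiv : ∀ x, (∑ i, fderiv ℝ b x (Pi.single i 1) i) = 0)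
    (horth : ∀ x, (∑ i, x i * b x i) = 0)
    (φ : ℝ → (Fin d → ℝ) → Fin d → ℝ)
    (hφ0 : ∀ x, φ 0 x = x)
    (hφ' : ∀ t x, HasDerivAt (fun s => φ s x) (b (φ t x)) t) :
    ∀ t : ℝ, Measure.map (φ t) (stdGaussian d) = stdGaussian d := by
  intro t
  have hc := GFlow.cont_flow hb horth hφ0 hφ' t
  have : IsProbabilityMeasure (stdGaussian d) := by unfold _root_.stdGaussian; infer_instance
  have := Measure.isProbabilityMeasure_map (μ := stdGaussian d) hc.measurable.aemeasurable
  refine GFlow.ext_lip _ _ fun f L hf hf1 => ?_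
  rw [integral_map hc.measurable.aemeasurable hf.continuous.aestronglyMeasurable,
    GFlow.integral_gauss, GFlow.integral_gauss]
  simp_rw [mul_left_comm _ ((√(2 * Real.pi))⁻¹ ^ d)]
  rw [integral_const_mul, integral_const_mul,
    GFlow.gauss_inv hb hdiv horth hφ0 hφ' hf hf1 t]
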